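/- Let F be an invertible real 3×3 matrix with det(F) > 0 and set J = det(F). The map Φ(F) = (det F)^(−1/3)·F from 3×3 matrices to 3×3 matrices is Fréchet differentiable at F, and its derivative applied to any 3×3 matrix H is given by DΦ(F)[H] = J^(−1/3)·(H − (1/3)·tr(F⁻¹·H)·F). -/

import Mathlib

open Matrix

attribute [local instance] Matrix.frobeniusNormedAddCommGroup Matrix.frobeniusNormedSpace

/-- Jacobi's formula: the derivative of the determinant at `F` is `H ↦ tr (adj F * H)`. -/
theorem Matrix.hasFDerivAt_det {n : Type*} [Fintype n] [DecidableEq n] (F : Matrix n n ℝ) :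
    HasFDerivAt (fun A : Matrix n n ℝ => A.det)
      (LinearMap.toContinuousLinearMap
        (Matrix.traceLinearMap n ℝ ℝ ∘ₗ LinearMap.mulLeft ℝ F.adjugate)) F := by
  let D : ContinuousMultilinearMap ℝ (fun _ : n => n → ℝ) ℝ :=
    { (Matrix.detRowAlternating (n := n) (R := ℝ)).toMultilinearMap with
      cont := Continuous.matrix_det (A := fun A : Matrix n n ℝ => A) continuous_id }
  have hD : HasFDerivAt (fun A : n → n → ℝ => D A) (D.linearDeriv F) F := D.hasFDerivAt F
  refine HasFDerivAt.congr_fderiv (E := Matrix n n ℝ) hD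
    (ContinuousLinearMap.ext fun (H : Matrix n n ℝ) => ?_)
  calc D.linearDeriv F H = ∑ i, (F.updateRow i (H i)).det := D.linearDeriv_apply F H
    _ = ∑ i, ∑ j, F.adjugate j i * H i j := by
      simp only [← Matrix.cramer_transpose_apply, Matrix.cramer_eq_adjugate_mulVec,
        ← Matrix.adjugate_transpose, Matrix.mulVec, dotProduct, Matrix.transpose_apply]
    _ = (F.adjugate * H).trace := by
      rw [Finset.sum_comm]
      rfl

/-- The Flory map `Φ(F) = (det F)^(-1/3) • F` is Fréchet differentiable at any `F` with
`det F > 0`, with derivative `H ↦ J^(-1/3) • (H - (1/3) tr(F⁻¹ H) • F)`. -/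
theorem flory_fderiv (F : Matrix (Fin 3) (Fin 3) ℝ) (hF : 0 < F.det) :
    ∃ L : Matrix (Fin 3) (Fin 3) ℝ →L[ℝ] Matrix (Fin 3) (Fin 3) ℝ,
      HasFDerivAt (fun A : Matrix (Fin 3) (Fin 3) ℝ => (A.det ^ (-(1/3) : ℝ)) • A) L F ∧
      ∀ H : Matrix (Fin 3) (Fin 3) ℝ,
        L H = (F.det ^ (-(1/3) : ℝ)) • (H - ((1/3) * (F⁻¹ * H).trace) • F) := by
  refine ⟨_, ((Matrix.hasFDerivAt_det F).rpow_const (Or.inl hF.ne')).smul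
    (hasFDerivAt_id F), fun H => ?_⟩
  have hinv : (F⁻¹ * H).trace = F.det⁻¹ * (F.adjugate * H).trace := by
    simp [Matrix.inv_def, Ring.inverse_eq_inv', Matrix.trace_smul]
  change F.det ^ (-(1/3) : ℝ) • H +
    ((-(1/3) * F.det ^ (-(1/3) - 1 : ℝ)) * (F.adjugate * H).trace) • F = _
  rw [hinv, Real.rpow_sub_one hF.ne']
  module
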